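/- Let H be a complex Hilbert space and let P and Q be orthogonal projections on H. Suppose λ is a real number with λ ≠ 0 and λ ≠ 1 and there exists a nonzero f ∈ H with PQPf = λf. Then both 1 + √λ and 1 − √λ are eigenvalues of P + Q. -/

import Mathlib

/-- If `P, Q` are orthogonal projections, `λ ≠ 0, 1` is real and `PQPf = λf` for some
nonzero `f`, then `1 ± √λ` are eigenvalues of `P + Q`. -/
theorem stmt_7 {H : Type*} [NormedAddCommGroup H] [InnerProductSpace ℂ H] [CompleteSpace H]
    (P Q : H →L[ℂ] H)
    (hP : IsSelfAdjoint P) (hP2 : P ∘L P = P)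
    (hQ : IsSelfAdjoint Q) (hQ2 : Q ∘L Q = Q)
    (l : ℝ) (hl0 : l ≠ 0) (hl1 : l ≠ 1)
    (f : H) (hf : f ≠ 0) (hPQP : P (Q (P f)) = (l : ℂ) • f) :
    (∃ g : H, g ≠ 0 ∧ (P + Q) g = ((1 + Real.sqrt l : ℝ) : ℂ) • g) ∧
    (∃ g : H, g ≠ 0 ∧ (P + Q) g = ((1 - Real.sqrt l : ℝ) : ℂ) • g) := by
  have hPP : ∀ x, P (P x) = P x := fun x => by
    simpa using congrArg (fun T : H →L[ℂ] H => T x) hP2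
  have hQQ : ∀ x, Q (Q x) = Q x := fun x => by
    simpa using congrArg (fun T : H →L[ℂ] H => T x) hQ2
  have hlC : (l : ℂ) ≠ 0 := by exact_mod_cast hl0
  have hPf : P f = f := by
    have h := congrArg P hPQP
    rw [hPP, hPQP, map_smul] at h
    exact (smul_right_injective H hlC h).symm
  rw [hPf] at hPQP
  have hlpos : 0 ≤ l := by
    have h1 : inner ℂ f (P (Q f)) = inner ℂ (Q f) (Q f) := by
      have a := ContinuousLinearMap.isSelfAdjoint_iff_isSymmetric.mp hP f (Q f)
      have b := ContinuousLinearMap.isSelfAdjoint_iff_isSymmetric.mp hQ f (Q f)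
      simp only [ContinuousLinearMap.coe_coe] at a b
      rw [← a, hPf, b, hQQ]
    rw [hPQP, inner_smul_right, inner_self_eq_norm_sq_to_K, inner_self_eq_norm_sq_to_K] at h1
    have h2 : l * ‖f‖ ^ 2 = ‖Q f‖ ^ 2 := by
      simp only [Complex.coe_algebraMap] at h1
      exact_mod_cast h1
    have h3 : 0 < ‖f‖ ^ 2 := by positivity
    by_contra hneg
    push Not at hneg
    nlinarith [sq_nonneg ‖Q f‖, mul_neg_of_neg_of_pos hneg h3]
  have key : ∀ c : ℝ, c ^ 2 = l → ∃ g : H, g ≠ 0 ∧ (P + Q) g = ((1 + c : ℝ) : ℂ) • g := by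
    intro c hc
    refine ⟨(c : ℂ) • f + Q f, ?_, ?_⟩
    · intro h0
      have h1 := congrArg Q h0
      rw [map_add, map_smul, hQQ, map_zero] at h1
      have h2 : ((c : ℂ) + 1) • Q f = 0 := by rw [add_smul, one_smul, h1]
      rcases smul_eq_zero.mp h2 with h | h
      · have h' : c + 1 = 0 := by exact_mod_cast h
        apply hl1
        rw [← hc, eq_neg_of_add_eq_zero_left h']
        norm_num
      · rw [h, map_zero] at hPQP
        exact (smul_ne_zero hlC hf) hPQP.symm
    · rw [ContinuousLinearMap.add_apply, map_add, map_add, map_smul, map_smul, hPf, hPQP, hQQ, ← hc]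
      push_cast
      module
  refine ⟨key _ (Real.sq_sqrt hlpos), ?_⟩
  have := key (-Real.sqrt l) (by rw [neg_sq, Real.sq_sqrt hlpos])
  simpa only [sub_eq_add_neg] using this
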